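/- arXiv:1703.09509 — 8 statements merged into one kernel-verified Lean document; each statement's English description precedes it below -/
import Mathlib

section
/- Let γ < 0 and let X be a bounded measurable random variable on a probability space (Ω, F, P). Then the entropic risk value (1/γ)·ln(∫ e^{γX} dP) equals the infimum, over all probability measures Q on (Ω, F) with Q ≪ P and finite relative entropy ∫ ln(dQ/dP) dQ, of the quantity ∫ X dQ − (1/γ)·∫ ln(dQ/dP) dQ. -/
open MeasureTheory

/-- The easy half of the Donsker–Varadhan variational formula: the log-partition function dominates
`∫ f dμ` minus the relative entropy of `μ` with respect to `ν`. -/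
theorem integral_sub_integral_llr_le_log_integral_exp {Ω : Type*} [MeasurableSpace Ω]
    {μ ν : Measure Ω} [IsProbabilityMeasure μ] [IsProbabilityMeasure ν] {f : Ω → ℝ}
    (hμν : μ ≪ ν) (hfμ : Integrable f μ) (hfν : Integrable (fun ω => Real.exp (f ω)) ν)
    (h_int : Integrable (llr μ ν) μ) :
    ∫ ω, f ω ∂μ - ∫ ω, llr μ ν ω ∂μ ≤ Real.log (∫ ω, Real.exp (f ω) ∂ν) := by
  have : IsProbabilityMeasure (ν.tilted f) := isProbabilityMeasure_tilted hfν
  have h_nonneg := InformationTheory.integral_llr_add_sub_measure_univ_nonneg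
    (hμν.trans (absolutelyContinuous_tilted hfν))
    (integrable_llr_tilted_right hμν hfμ h_int hfν)
  simp only [probReal_univ, integral_llr_tilted_right hμν hfμ hfν h_int] at h_nonneg
  linarith

/-- The tilted measure `μ.tilted f` has log-likelihood ratio `f - log ∫ exp f dμ` with respect
to `μ`, almost surely under the tilted measure itself. -/
theorem llr_tilted_self_ae_eq {Ω : Type*} [MeasurableSpace Ω] {μ : Measure Ω} [SigmaFinite μ]
    {f : Ω → ℝ} (hf : Integrable (fun ω => Real.exp (f ω)) μ) :
    llr (μ.tilted f) μ =ᵐ[μ.tilted f] fun ω => f ω - Real.log (∫ ω, Real.exp (f ω) ∂μ) :=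
  (tilted_absolutelyContinuous μ f).ae_le (log_rnDeriv_tilted_left_self hf)

/-- Dual (robust) representation of the entropic risk measure: for `γ < 0` and a bounded
measurable random variable `X`, the entropic risk value `(1/γ)·ln ∫ e^{γX} dP` equals the
infimum over all probability measures `Q ≪ P` with finite relative entropy
`∫ ln(dQ/dP) dQ` of `∫ X dQ − (1/γ)·∫ ln(dQ/dP) dQ`. -/
theorem entropic_risk_dual_representation
    {Ω : Type*} [MeasurableSpace Ω] (P : Measure Ω) [IsProbabilityMeasure P]
    (X : Ω → ℝ) (hX : Measurable X) (C : ℝ) (hXbd : ∀ ω, |X ω| ≤ C)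
    (γ : ℝ) (hγ : γ < 0) :
    (1 / γ) * Real.log (∫ ω, Real.exp (γ * X ω) ∂P) =
      sInf {r : ℝ | ∃ Q : Measure Ω, IsProbabilityMeasure Q ∧ Q ≪ P ∧
        Integrable (fun ω => Real.log ((Q.rnDeriv P) ω).toReal) Q ∧
        r = ∫ ω, X ω ∂Q
            - (1 / γ) * ∫ ω, Real.log ((Q.rnDeriv P) ω).toReal ∂Q} := by
  have hX_int (Q : Measure Ω) [IsProbabilityMeasure Q] : Integrable X Q :=
    Integrable.of_bound hX.aestronglyMeasurable C (ae_of_all _ hXbd)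
  have h_exp : Integrable (fun ω => Real.exp (γ * X ω)) P := by
    refine Integrable.of_bound (by fun_prop) (Real.exp (|γ| * C)) (ae_of_all _ fun ω => ?_)
    rw [Real.norm_eq_abs, Real.abs_exp, Real.exp_le_exp]
    calc γ * X ω ≤ |γ * X ω| := le_abs_self _
      _ = |γ| * |X ω| := abs_mul _ _
      _ ≤ |γ| * C := by gcongr; exact hXbd ω
  have hγ_ne : γ ≠ 0 := hγ.ne
  refine (IsLeast.csInf_eq ⟨?_, ?_⟩).symm
  · have : IsProbabilityMeasure (P.tilted fun ω => γ * X ω) := isProbabilityMeasure_tilted h_exp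
    have h_llr := llr_tilted_self_ae_eq h_exp
    have hγX := (hX_int (P.tilted fun ω => γ * X ω)).const_mul γ
    refine ⟨P.tilted fun ω => γ * X ω, this, tilted_absolutelyContinuous _ _,
      (integrable_congr h_llr).2 (hγX.sub (integrable_const _)), ?_⟩
    simp only [← llr_def]
    rw [integral_congr_ae h_llr, integral_sub hγX (integrable_const _), integral_const_mul,
      integral_const, probReal_univ, one_smul]
    field_simp
    ring
  · rintro _ ⟨Q, hQ, hQP, h_int, rfl⟩
    have h := integral_sub_integral_llr_le_log_integral_exp hQP ((hX_int Q).const_mul γ) h_exp h_int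
    rw [integral_const_mul] at h
    calc (1 / γ) * Real.log (∫ ω, Real.exp (γ * X ω) ∂P)
        ≤ (1 / γ) * (γ * ∫ ω, X ω ∂Q - ∫ ω, llr Q P ω ∂Q) :=
          mul_le_mul_of_nonpos_left h (one_div_nonpos.2 hγ.le)
      _ = ∫ ω, X ω ∂Q - (1 / γ) * ∫ ω, llr Q P ω ∂Q := by field_simp
end

section
/- Let γ < 0 and let X be a bounded measurable random variable on a probability space (Ω, F, P). Define the probability measure Q* on (Ω, F) by dQ*/dP = e^{γX} / ∫ e^{γX} dP. Then Q* ≪ P and ∫ X dQ* − (1/γ)·∫ ln(dQ*/dP) dQ* = (1/γ)·ln(∫ e^{γX} dP); that is, the infimum in the dual representation of the entropic risk measure is attained at Q*. -/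
open MeasureTheory

/-- The infimum in the dual representation of the entropic risk measure is attained at the
measure `Q*` with density `dQ*/dP = e^{γX} / ∫ e^{γX} dP`: `Q*` is a probability measure,
`Q* ≪ P`, and `∫ X dQ* − (1/γ)·∫ ln(dQ*/dP) dQ* = (1/γ)·ln ∫ e^{γX} dP`. -/
theorem entropic_risk_dual_attained
    {Ω : Type*} [MeasurableSpace Ω] (P : Measure Ω) [IsProbabilityMeasure P]
    (X : Ω → ℝ) (hX : Measurable X) (C : ℝ) (hXbd : ∀ ω, |X ω| ≤ C)
    (γ : ℝ) (hγ : γ < 0)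
    (Q : Measure Ω)
    (hQ : Q = P.withDensity fun ω =>
        ENNReal.ofReal (Real.exp (γ * X ω) / ∫ ω', Real.exp (γ * X ω') ∂P)) :
    IsProbabilityMeasure Q ∧ Q ≪ P ∧
      ∫ ω, X ω ∂Q - (1 / γ) * ∫ ω, Real.log ((Q.rnDeriv P) ω).toReal ∂Q
        = (1 / γ) * Real.log (∫ ω, Real.exp (γ * X ω) ∂P) := by
  change Q = P.tilted (fun ω => γ * X ω) at hQ
  have hexp : Integrable (fun ω => Real.exp (γ * X ω)) P :=
    Integrable.of_bound (by fun_prop) (Real.exp (|γ| * C)) <| ae_of_all _ fun ω => by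
      rw [Real.norm_eq_abs, Real.abs_exp, Real.exp_le_exp]
      calc γ * X ω ≤ |γ * X ω| := le_abs_self _
        _ = |γ| * |X ω| := abs_mul _ _
        _ ≤ |γ| * C := by gcongr; exact hXbd ω
  have hprob : IsProbabilityMeasure Q := hQ ▸ isProbabilityMeasure_tilted hexp
  have hac : Q ≪ P := hQ ▸ tilted_absolutelyContinuous P _
  refine ⟨hprob, hac, ?_⟩
  have hXint : Integrable X Q :=
    Integrable.of_bound hX.aestronglyMeasurable C (ae_of_all _ hXbd)
  have hlog : (fun ω => Real.log (Q.rnDeriv P ω).toReal) =ᵐ[Q]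
      fun ω => γ * X ω - Real.log (∫ ω', Real.exp (γ * X ω') ∂P) := by
    apply hac.ae_le
    rw [hQ]
    exact log_rnDeriv_tilted_left_self hexp
  rw [integral_congr_ae hlog, integral_sub (hXint.const_mul γ) (integrable_const _),
    integral_const_mul, integral_const, probReal_univ, one_smul]
  field_simp [hγ.ne]
  ring
end

section
/- Suppose U = r ∘ W for an increasing concave function r : ℝ → ℝ (i.e., U is more risk averse than W). Then for every n ∈ ℕ and every z ∈ E it holds that V_n^U(z) ≤ r(V_n^W(z)). -/
open MeasureTheory ProbabilityTheory

/-- The value functions of a stopping problem with bounded measurable reward `h` and monotone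
utility `F` are measurable and take values between `F (-C)` and `F C`. -/
theorem valueFunction_measurable_and_mem_Icc {E : Type*} [MeasurableSpace E]
    (κ : Kernel E E) [IsMarkovKernel κ] {h : E → ℝ} (hh : Measurable h) {C : ℝ}
    (hbd : ∀ z, |h z| ≤ C) {F : ℝ → ℝ} (hF : Monotone F) {V : ℕ → E → ℝ}
    (hV0 : V 0 = F ∘ h)
    (hVs : ∀ n z, V (n + 1) z = max (F (h z)) (∫ z', V n z' ∂(κ z))) (n : ℕ) :
    Measurable (V n) ∧ ∀ z, V n z ∈ Set.Icc (F (-C)) (F C) := by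
  have hFh : ∀ z, F (h z) ∈ Set.Icc (F (-C)) (F C) := fun z =>
    ⟨hF (abs_le.mp (hbd z)).1, hF (abs_le.mp (hbd z)).2⟩
  induction n with
  | zero => rw [hV0]; exact ⟨hF.measurable.comp hh, hFh⟩
  | succ n ih =>
    obtain ⟨hm, hb⟩ := ih
    constructor
    · rw [funext (hVs n)]
      exact (hF.measurable.comp hh).max hm.stronglyMeasurable.integral_kernel.measurable
    · intro z
      rw [hVs]
      refine ⟨(hFh z).1.trans (le_max_left _ _), max_le (hFh z).2 ?_⟩
      have hint : Integrable (V n) (κ z) :=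
        Integrable.of_mem_Icc _ _ hm.aemeasurable (ae_of_all _ hb)
      simpa using integral_mono hint (integrable_const (F C)) fun z' => (hb z').2

/-- If the utility `U = r ∘ W` is more risk averse than `W` (with `r` increasing and
concave), then the value functions of the corresponding stopping problems satisfy
`V_n^U(z) ≤ r(V_n^W(z))` for all `n` and `z`. -/
theorem value_function_risk_aversion_comparison
    {E : Type*} [MeasurableSpace E]
    (κ : Kernel E E) [IsMarkovKernel κ]
    (h : E → ℝ) (hh : Measurable h) (C : ℝ) (hbd : ∀ z, |h z| ≤ C)
    (U W : ℝ → ℝ) (hU : StrictMono U) (hUconc : ConcaveOn ℝ Set.univ U)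
    (hW : StrictMono W) (hWconc : ConcaveOn ℝ Set.univ W)
    (r : ℝ → ℝ) (hr : Monotone r) (hrconc : ConcaveOn ℝ Set.univ r)
    (hUrW : U = r ∘ W)
    (VU VW : ℕ → E → ℝ)
    (hVU0 : VU 0 = U ∘ h)
    (hVUs : ∀ n z, VU (n + 1) z = max (U (h z)) (∫ z', VU n z' ∂(κ z)))
    (hVW0 : VW 0 = W ∘ h)
    (hVWs : ∀ n z, VW (n + 1) z = max (W (h z)) (∫ z', VW n z' ∂(κ z))) :
    ∀ (n : ℕ) (z : E), VU n z ≤ r (VW n z) := by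
  have hbU := valueFunction_measurable_and_mem_Icc κ hh hbd hU.monotone hVU0 hVUs
  have hbW := valueFunction_measurable_and_mem_Icc κ hh hbd hW.monotone hVW0 hVWs
  intro n
  induction n with
  | zero => intro z; simp [hVU0, hVW0, hUrW]
  | succ n ih =>
    intro z
    obtain ⟨hmU, hU_mem⟩ := hbU n
    obtain ⟨hmW, hW_mem⟩ := hbW n
    have hintU : Integrable (VU n) (κ z) :=
      Integrable.of_mem_Icc _ _ hmU.aemeasurable (ae_of_all _ hU_mem)
    have hintW : Integrable (VW n) (κ z) :=
      Integrable.of_mem_Icc _ _ hmW.aemeasurable (ae_of_all _ hW_mem)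
    have hintr : Integrable (r ∘ VW n) (κ z) :=
      Integrable.of_mem_Icc _ _ (hr.measurable.comp hmW).aemeasurable
        (ae_of_all _ fun z' => ⟨hr (hW_mem z').1, hr (hW_mem z').2⟩)
    rw [hVUs, hVWs, hr.map_max]
    refine max_le_max (by simp [hUrW]) ?_
    calc ∫ z', VU n z' ∂(κ z) ≤ ∫ z', r (VW n z') ∂(κ z) := integral_mono hintU hintr ih
      _ ≤ r (∫ z', VW n z' ∂(κ z)) :=
        hrconc.le_map_integral (hrconc.continuousOn isOpen_univ) isClosed_univ
          (ae_of_all _ fun _ => Set.mem_univ _) hintW hintr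
end

section
/- Suppose U = r ∘ W for an increasing concave function r : ℝ → ℝ (i.e., U is more risk averse than W). Then for every n ≥ 1 and every z ∈ E, if W(h(z)) ≥ ∫ V_{n−1}^W(z') κ(z, dz') (i.e., the W-decision maker stops at z with n steps to go), then U(h(z)) ≥ ∫ V_{n−1}^U(z') κ(z, dz') (the U-decision maker also stops); that is, a more risk-averse decision maker will not stop later. -/
open MeasureTheory ProbabilityTheory

theorem integrable_of_measurable_of_mem_Icc {E : Type*} [MeasurableSpace E] {μ : Measure E}
    [IsFiniteMeasure μ] {f : E → ℝ} {a b : ℝ} (hf : Measurable f)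
    (hab : ∀ z, f z ∈ Set.Icc a b) : Integrable f μ :=
  Integrable.of_mem_Icc a b hf.aemeasurable (Filter.Eventually.of_forall hab)

/-- The value functions of a stopping problem are measurable and keep the bounds of the reward. -/
theorem measurable_and_mem_Icc_of_stopping_recursion {E : Type*} [MeasurableSpace E]
    (κ : Kernel E E) [IsMarkovKernel κ] {g : E → ℝ} {a b : ℝ} (hg : Measurable g)
    (hab : ∀ z, g z ∈ Set.Icc a b) {V : ℕ → E → ℝ} (h0 : V 0 = g)
    (hs : ∀ n z, V (n + 1) z = max (g z) (∫ z', V n z' ∂(κ z))) (n : ℕ) :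
    Measurable (V n) ∧ ∀ z, V n z ∈ Set.Icc a b := by
  induction n with
  | zero => exact h0 ▸ ⟨hg, hab⟩
  | succ n ih =>
    obtain ⟨hm, hb⟩ := ih
    refine ⟨?_, fun z => ?_⟩
    · rw [funext (hs n)]
      exact hg.max hm.stronglyMeasurable.integral_kernel.measurable
    · rw [hs]
      have hle : ∫ z', V n z' ∂(κ z) ≤ b := by
        simpa using integral_mono (integrable_of_measurable_of_mem_Icc (μ := κ z) hm hb)
          (integrable_const b) fun z' => (hb z').2
      exact ⟨le_max_of_le_left (hab z).1, max_le (hab z).2 hle⟩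

/-- Bounded form of Jensen's inequality for monotone concave functions on the real line. -/
theorem integral_le_map_integral_of_le_comp {E : Type*} [MeasurableSpace E] {μ : Measure E}
    [IsProbabilityMeasure μ] {r : ℝ → ℝ} (hr : Monotone r) (hrconc : ConcaveOn ℝ Set.univ r)
    {f g : E → ℝ} {a b : ℝ} (hf : Integrable f μ) (hg : Measurable g)
    (hab : ∀ z, g z ∈ Set.Icc a b) (hfg : ∀ z, f z ≤ r (g z)) :
    ∫ z, f z ∂μ ≤ r (∫ z, g z ∂μ) := by
  have hrg : Integrable (r ∘ g) μ :=
    integrable_of_measurable_of_mem_Icc (hr.measurable.comp hg)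
      fun z => ⟨hr (hab z).1, hr (hab z).2⟩
  calc ∫ z, f z ∂μ ≤ ∫ z, r (g z) ∂μ := integral_mono hf hrg hfg
    _ ≤ r (∫ z, g z ∂μ) :=
      hrconc.le_map_integral (hrconc.continuousOn isOpen_univ) isClosed_univ (by simp)
        (integrable_of_measurable_of_mem_Icc hg hab) hrg

/-- A more risk-averse decision maker will not stop later: if `U = r ∘ W` with `r`
increasing and concave, and if the `W`-decision maker stops at `z` with `n ≥ 1` steps to go
(i.e. `W(h(z)) ≥ ∫ V_{n−1}^W dκ(z)`), then the `U`-decision maker also stops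
(i.e. `U(h(z)) ≥ ∫ V_{n−1}^U dκ(z)`). -/
theorem more_risk_averse_stops_earlier
    {E : Type*} [MeasurableSpace E]
    (κ : Kernel E E) [IsMarkovKernel κ]
    (h : E → ℝ) (hh : Measurable h) (C : ℝ) (hbd : ∀ z, |h z| ≤ C)
    (U W : ℝ → ℝ) (hU : StrictMono U) (hUconc : ConcaveOn ℝ Set.univ U)
    (hW : StrictMono W) (hWconc : ConcaveOn ℝ Set.univ W)
    (r : ℝ → ℝ) (hr : Monotone r) (hrconc : ConcaveOn ℝ Set.univ r)
    (hUrW : U = r ∘ W)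
    (VU VW : ℕ → E → ℝ)
    (hVU0 : VU 0 = U ∘ h)
    (hVUs : ∀ n z, VU (n + 1) z = max (U (h z)) (∫ z', VU n z' ∂(κ z)))
    (hVW0 : VW 0 = W ∘ h)
    (hVWs : ∀ n z, VW (n + 1) z = max (W (h z)) (∫ z', VW n z' ∂(κ z))) :
    ∀ (n : ℕ), 1 ≤ n → ∀ z : E,
      (∫ z', VW (n - 1) z' ∂(κ z)) ≤ W (h z) →
      (∫ z', VU (n - 1) z' ∂(κ z)) ≤ U (h z) := by
  have hbounds : ∀ F : ℝ → ℝ, StrictMono F → ∀ z, F (h z) ∈ Set.Icc (F (-C)) (F C) :=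
    fun F hF z => ⟨hF.monotone (abs_le.1 (hbd z)).1, hF.monotone (abs_le.1 (hbd z)).2⟩
  have hVU := measurable_and_mem_Icc_of_stopping_recursion κ (hU.monotone.measurable.comp hh)
    (hbounds U hU) hVU0 hVUs
  have hVW := measurable_and_mem_Icc_of_stopping_recursion κ (hW.monotone.measurable.comp hh)
    (hbounds W hW) hVW0 hVWs
  have hint : ∀ n, (∀ z, VU n z ≤ r (VW n z)) → ∀ z,
      ∫ z', VU n z' ∂(κ z) ≤ r (∫ z', VW n z' ∂(κ z)) := fun n hn z =>
    integral_le_map_integral_of_le_comp hr hrconc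
      (integrable_of_measurable_of_mem_Icc (hVU n).1 (hVU n).2) (hVW n).1 (hVW n).2 hn
  have hle : ∀ n z, VU n z ≤ r (VW n z) := by
    intro n
    induction n with
    | zero => intro z; simp [hVU0, hVW0, hUrW]
    | succ n ih =>
      intro z
      rw [hVUs, hVWs, hr.map_max]
      exact max_le_max (by simp [hUrW]) (hint n ih z)
  intro n _ z hz
  calc ∫ z', VU (n - 1) z' ∂(κ z) ≤ r (∫ z', VW (n - 1) z' ∂(κ z)) := hint _ (hle _) z
    _ ≤ r (W (h z)) := hr hz
    _ = U (h z) := by simp [hUrW]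
end

section
/- The sequence of value functions (V_n) is pointwise increasing and uniformly bounded, hence has a pointwise limit V(z) := sup_n V_n(z), and this limit satisfies the fixed point equation V(z) = max{G(z), ∫ V(z') κ(z, dz')} for every z ∈ E. -/
open MeasureTheory ProbabilityTheory Filter

/-- The sequence of value functions `V 0 = G`, `V (n+1) z = max {G z, ∫ V n dκ(z)}` is
pointwise increasing and uniformly bounded, hence has a pointwise limit
`V z = ⨆ n, V n z`, and this limit satisfies the fixed point equation
`V z = max {G z, ∫ V dκ(z)}`. -/
theorem value_functions_limit_fixed_point
    {E : Type*} [MeasurableSpace E]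
    (κ : Kernel E E) [IsMarkovKernel κ]
    (G : E → ℝ) (hG : Measurable G) (C : ℝ) (hGbd : ∀ z, |G z| ≤ C)
    (V : ℕ → E → ℝ) (hV0 : V 0 = G)
    (hVs : ∀ n z, V (n + 1) z = max (G z) (∫ z', V n z' ∂(κ z))) :
    (∀ z, Monotone fun n => V n z) ∧
    (∃ D : ℝ, ∀ (n : ℕ) (z : E), |V n z| ≤ D) ∧
    (∀ z, Tendsto (fun n => V n z) atTop (nhds (⨆ n, V n z))) ∧
    (∀ z, (⨆ n, V n z) = max (G z) (∫ z', (⨆ n, V n z') ∂(κ z))) := by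
  have hmeas : ∀ n, Measurable (V n) := by
    intro n
    induction n with
    | zero => rwa [hV0]
    | succ n ih =>
      rw [show V (n + 1) = fun z => max (G z) (∫ z', V n z' ∂(κ z)) from funext (hVs n)]
      exact hG.max ih.stronglyMeasurable.integral_kernel.measurable
  have hbd : ∀ n z, |V n z| ≤ C := by
    intro n
    induction n with
    | zero => rwa [hV0]
    | succ n ih =>
      intro z
      rw [hVs]
      have hint : |∫ z', V n z' ∂(κ z)| ≤ C := by
        simpa using norm_integral_le_of_norm_le_const (μ := κ z) (f := V n) (C := C) (ae_of_all _ ih)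
      exact abs_max_le_max_abs_abs.trans (max_le (hGbd z) hint)
  have hint : ∀ n z, Integrable (V n) (κ z) := fun n z =>
    Integrable.of_bound (hmeas n).aestronglyMeasurable C (ae_of_all _ (hbd n))
  have hstep : ∀ n z, V n z ≤ V (n + 1) z := by
    intro n
    induction n with
    | zero =>
      intro z
      rw [hVs, hV0]
      exact le_max_left _ _
    | succ n ih =>
      intro z
      rw [hVs, hVs (n + 1)]
      exact max_le_max le_rfl (integral_mono (hint n z) (hint (n + 1) z) ih)
  have hmono : ∀ z, Monotone fun n => V n z := fun z => monotone_nat_of_le_succ (hstep · z)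
  have hlim : ∀ z, Tendsto (fun n => V n z) atTop (nhds (⨆ n, V n z)) := fun z =>
    tendsto_atTop_ciSup (hmono z) ⟨C, by rintro _ ⟨n, rfl⟩; exact (abs_le.mp (hbd n z)).2⟩
  refine ⟨hmono, ⟨C, hbd⟩, hlim, fun z => ?_⟩
  have hlim_int : Tendsto (fun n => ∫ z', V n z' ∂(κ z)) atTop
      (nhds (∫ z', (⨆ n, V n z') ∂(κ z))) :=
    tendsto_integral_of_dominated_convergence (fun _ => C)
      (fun n => (hmeas n).aestronglyMeasurable) (integrable_const C)
      (fun n => ae_of_all _ (hbd n)) (ae_of_all _ hlim)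
  refine tendsto_nhds_unique ((tendsto_add_atTop_iff_nat 1).mpr (hlim z)) ?_
  simp only [hVs]
  exact tendsto_const_nhds.max hlim_int
end

section
/- For every n ≥ 1 and every probability measure μ on ℝ, the reservation levels of the exponential-utility Bayesian house selling problem satisfy x^γ_n(μ) ≤ x^γ_{n+1}(μ); that is, the reservation levels are increasing in the number of remaining stages. -/
open MeasureTheory

/-- The distribution `Q_μ` of the next offer given the conditional distribution `μ` of the
unknown parameter: the measure on `ℝ` with `λ`-density `x ↦ ∫ q(x,θ) μ(dθ)`. -/
noncomputable def offerMeasure (lam : Measure ℝ) (q : ℝ → ℝ → ℝ) (μ : Measure ℝ) :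
    Measure ℝ :=
  lam.withDensity fun x => ENNReal.ofReal (∫ θ, q x θ ∂μ)

/-- The Bayes updating operator `Φ(x, μ)`: the measure with `μ`-density
`θ ↦ q(x,θ) / ∫ q(x,θ') μ(dθ')` when the denominator is positive, and `μ` otherwise. -/
noncomputable def bayesUpdate (q : ℝ → ℝ → ℝ) (x : ℝ) (μ : Measure ℝ) : Measure ℝ :=
  if 0 < ∫ θ, q x θ ∂μ then
    μ.withDensity fun θ => ENNReal.ofReal (q x θ / ∫ θ', q x θ' ∂μ)
  else μ

/-- The reservation levels of the exponential-utility Bayesian house selling problem;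
`resLevel lam q c γ n μ` is the reservation level `x^γ_{n+1}(μ)` with `n+1` remaining
stages:  `x^γ_1(μ) = −c + (1/γ)·ln ∫ e^{γx} Q_μ(dx)` and
`x^γ_{n+1}(μ) = −c + (1/γ)·ln ∫ e^{γ·max{x, x^γ_n(Φ(x,μ))}} Q_μ(dx)`. -/
noncomputable def resLevel (lam : Measure ℝ) (q : ℝ → ℝ → ℝ) (c γ : ℝ) :
    ℕ → Measure ℝ → ℝ
  | 0, μ => -c + (1 / γ) * Real.log (∫ x, Real.exp (γ * x) ∂(offerMeasure lam q μ))
  | n + 1, μ => -c + (1 / γ) * Real.log (∫ x,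
      Real.exp (γ * max x (resLevel lam q c γ n (bayesUpdate q x μ)))
        ∂(offerMeasure lam q μ))

theorem isProbabilityMeasure_bayesUpdate {q : ℝ → ℝ → ℝ} (hqnn : ∀ x θ, 0 ≤ q x θ) (x : ℝ)
    (μ : Measure ℝ) [IsProbabilityMeasure μ] : IsProbabilityMeasure (bayesUpdate q x μ) := by
  unfold bayesUpdate
  split_ifs with h
  · have hint : Integrable (fun θ => q x θ) μ := by
      by_contra hn
      exact h.ne' (integral_undef hn)
    constructor
    rw [withDensity_apply _ MeasurableSet.univ, Measure.restrict_univ,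
      ← ofReal_integral_eq_lintegral_ofReal (hint.div_const _)
        (ae_of_all _ fun θ => div_nonneg (hqnn x θ) h.le),
      integral_div, div_self h.ne', ENNReal.ofReal_one]
  · infer_instance

theorem measurable_offerDensity {q : ℝ → ℝ → ℝ} (hq : Measurable (Function.uncurry q))
    (μ : Measure ℝ) [IsProbabilityMeasure μ] :
    Measurable fun x => ENNReal.ofReal (∫ θ, q x θ ∂μ) :=
  hq.stronglyMeasurable.integral_prod_right.measurable.ennreal_ofReal

theorem isProbabilityMeasure_offerMeasure {lam : Measure ℝ} [SigmaFinite lam] {q : ℝ → ℝ → ℝ}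
    (hq : Measurable (Function.uncurry q)) (hqnn : ∀ x θ, 0 ≤ q x θ)
    (hqdens : ∀ θ, ∫ x, q x θ ∂lam = 1) (μ : Measure ℝ) [IsProbabilityMeasure μ] :
    IsProbabilityMeasure (offerMeasure lam q μ) := by
  have hone : ∀ θ, ∫⁻ x, ENNReal.ofReal (q x θ) ∂lam = 1 := fun θ => by
    have hint : Integrable (fun x => q x θ) lam := by
      by_contra hn
      have := hqdens θ
      rw [integral_undef hn] at this
      exact zero_ne_one this
    rw [← ofReal_integral_eq_lintegral_ofReal hint (ae_of_all _ fun x => hqnn x θ), hqdens,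
      ENNReal.ofReal_one]
  have htot : ∫⁻ x, ∫⁻ θ, ENNReal.ofReal (q x θ) ∂μ ∂lam = 1 := by
    rw [lintegral_lintegral_swap (f := fun x θ => ENNReal.ofReal (q x θ))
      hq.ennreal_ofReal.aemeasurable]
    simp [hone]
  have hmeas : Measurable fun x => ∫⁻ θ, ENNReal.ofReal (q x θ) ∂μ :=
    Measurable.lintegral_prod_right' (f := fun p : ℝ × ℝ => ENNReal.ofReal (q p.1 p.2))
      hq.ennreal_ofReal
  constructor
  rw [offerMeasure, withDensity_apply _ MeasurableSet.univ, Measure.restrict_univ, ← htot]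
  refine lintegral_congr_ae ?_
  filter_upwards [ae_lt_top hmeas (by simp [htot])] with x hx
  rw [integral_eq_lintegral_of_nonneg_ae (ae_of_all _ (hqnn x))
    (hq.of_uncurry_left (x := x)).aestronglyMeasurable, ENNReal.ofReal_toReal hx.ne]

theorem ae_offerMeasure_mem_Icc {lam : Measure ℝ} {m M : ℝ} {q : ℝ → ℝ → ℝ}
    (hq : Measurable (Function.uncurry q))
    (hqsupp : ∀ x θ, x ∉ Set.Icc m M → q x θ = 0) (μ : Measure ℝ) [IsProbabilityMeasure μ] :
    ∀ᵐ x ∂(offerMeasure lam q μ), x ∈ Set.Icc m M := by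
  rw [offerMeasure, ae_withDensity_iff (measurable_offerDensity hq μ)]
  refine ae_of_all _ fun x hx => ?_
  by_contra hn
  simp [hqsupp x _ hn] at hx

/-- For `γ < 0`, a certainty equivalent `(1/γ) ln E[e^{γ f}]` is monotone in `f`. -/
theorem certaintyEquivalent_mono {P : Measure ℝ} [NeZero P] {γ : ℝ} (hγ : γ < 0)
    {f g : ℝ → ℝ} (hf : Integrable (fun x => Real.exp (γ * f x)) P)
    (hg : Integrable (fun x => Real.exp (γ * g x)) P) (hfg : ∀ x, f x ≤ g x) :
    (1 / γ) * Real.log (∫ x, Real.exp (γ * f x) ∂P) ≤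
      (1 / γ) * Real.log (∫ x, Real.exp (γ * g x) ∂P) := by
  refine mul_le_mul_of_nonpos_left ?_ (one_div_neg.mpr hγ).le
  refine Real.log_le_log (integral_exp_pos hg) (integral_mono hg hf fun x => ?_)
  exact Real.exp_le_exp.mpr (mul_le_mul_of_nonpos_left (hfg x) hγ.le)

/-- The reservation levels of the exponential-utility Bayesian house selling problem are
increasing in the number of remaining stages: `x^γ_n(μ) ≤ x^γ_{n+1}(μ)` for all `n ≥ 1`
(here `resLevel lam q c γ n = x^γ_{n+1}`). -/
theorem resLevel_increasing_in_remaining_stages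
    (lam : Measure ℝ) [SigmaFinite lam] (m M : ℝ) (hmM : m < M)
    (q : ℝ → ℝ → ℝ) (hq : Measurable (Function.uncurry q))
    (hqnn : ∀ x θ, 0 ≤ q x θ)
    (hqdens : ∀ θ, ∫ x, q x θ ∂lam = 1)
    (hqsupp : ∀ x θ, x ∉ Set.Icc m M → q x θ = 0)
    (c : ℝ) (hc : 0 < c) (γ : ℝ) (hγ : γ < 0)
    (hmeas : ∀ (n : ℕ) (μ : Measure ℝ), IsProbabilityMeasure μ →
      Measurable fun x => resLevel lam q c γ n (bayesUpdate q x μ)) :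
    ∀ (n : ℕ) (μ : Measure ℝ), IsProbabilityMeasure μ →
      resLevel lam q c γ n μ ≤ resLevel lam q c γ (n + 1) μ := by
  have hbound : ∀ (μ : Measure ℝ), IsProbabilityMeasure μ → ∀ f : ℝ → ℝ, Measurable f →
      (∀ x, x ≤ f x) → Integrable (fun x => Real.exp (γ * f x)) (offerMeasure lam q μ) := by
    intro μ hμ f hf hle
    have := isProbabilityMeasure_offerMeasure hq hqnn hqdens μ
    refine Integrable.of_bound (hf.const_mul γ).exp.aestronglyMeasurable (Real.exp (γ * m)) ?_
    filter_upwards [ae_offerMeasure_mem_Icc (lam := lam) hq hqsupp μ] with x hx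
    rw [Real.norm_eq_abs, Real.abs_exp]
    exact Real.exp_le_exp.mpr (mul_le_mul_of_nonpos_left (hx.1.trans (hle x)) hγ.le)
  have hmax : ∀ (n : ℕ) (μ : Measure ℝ), IsProbabilityMeasure μ →
      Integrable (fun x => Real.exp (γ * max x (resLevel lam q c γ n (bayesUpdate q x μ))))
        (offerMeasure lam q μ) := fun n μ hμ =>
    hbound μ hμ _ (measurable_id.max (hmeas n μ hμ)) fun x => le_max_left _ _
  intro n
  induction n with
  | zero =>
    intro μ hμ
    have := isProbabilityMeasure_offerMeasure hq hqnn hqdens μ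
    exact add_le_add_right (certaintyEquivalent_mono hγ
      (hbound μ hμ _ measurable_id fun _ => le_rfl) (hmax 0 μ hμ) fun _ => le_max_left _ _) _
  | succ n ih =>
    intro μ hμ
    have := isProbabilityMeasure_offerMeasure hq hqnn hqdens μ
    exact add_le_add_right (certaintyEquivalent_mono hγ (hmax n μ hμ) (hmax (n + 1) μ hμ)
      fun x => max_le_max le_rfl (ih _ (isProbabilityMeasure_bayesUpdate hqnn x μ))) _
end

section
/- Let γ₁ ≤ γ₂ < 0. Then for every n ≥ 1 and every probability measure μ on ℝ, the reservation levels of the exponential-utility Bayesian house selling problem satisfy x^{γ₁}_n(μ) ≤ x^{γ₂}_n(μ); that is, the reservation levels are increasing in the risk-aversion parameter γ. -/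
open MeasureTheory

/-- The certainty equivalent `(1/γ) ln E[exp (γ f)]` is monotone in `γ < 0` and in `f`. -/
theorem certaintyEquivalent_mono_s9 {α : Type*} [MeasurableSpace α] {ν : Measure α}
    [IsProbabilityMeasure ν] {f g : α → ℝ} (hf : Measurable f) (hg : Measurable g) {m : ℝ}
    (hmf : ∀ᵐ x ∂ν, m ≤ f x) (hfg : ∀ x, f x ≤ g x) {γ₁ γ₂ : ℝ} (h₁₂ : γ₁ ≤ γ₂)
    (h₂ : γ₂ < 0) :
    (1 / γ₁) * Real.log (∫ x, Real.exp (γ₁ * f x) ∂ν) ≤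
      (1 / γ₂) * Real.log (∫ x, Real.exp (γ₂ * g x) ∂ν) := by
  have integrable_exp : ∀ {h : α → ℝ} {γ : ℝ}, Measurable h → (∀ᵐ x ∂ν, m ≤ h x) → γ < 0 →
      Integrable (fun x => Real.exp (γ * h x)) ν := by
    intro h γ hh hmh hγ
    refine Integrable.of_bound (by fun_prop) (Real.exp (γ * m)) ?_
    filter_upwards [hmh] with x hx
    rw [Real.norm_eq_abs, Real.abs_exp]
    exact Real.exp_le_exp.mpr (mul_le_mul_of_nonpos_left hx hγ.le)
  have h₁ : γ₁ < 0 := h₁₂.trans_lt h₂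
  have hf₁ := integrable_exp hf hmf h₁
  have hf₂ := integrable_exp hf hmf h₂
  have hg₂ := integrable_exp hg (hmf.mono fun x hx => hx.trans (hfg x)) h₂
  have hp : 1 ≤ γ₁ / γ₂ := (one_le_div_of_neg h₂).mpr h₁₂
  have hpow : ∀ x, Real.exp (γ₂ * f x) ^ (γ₁ / γ₂) = Real.exp (γ₁ * f x) := by
    intro x
    rw [← Real.exp_mul]
    congr 1
    have := h₂.ne
    field_simp
  have hjensen : (∫ x, Real.exp (γ₂ * f x) ∂ν) ^ (γ₁ / γ₂) ≤ ∫ x, Real.exp (γ₁ * f x) ∂ν := by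
    have := (convexOn_rpow hp).map_integral_le (μ := ν) (f := fun x => Real.exp (γ₂ * f x))
      (Real.continuous_rpow_const (zero_le_one.trans hp)).continuousOn isClosed_Ici
      (Filter.Eventually.of_forall fun x => (Real.exp_pos _).le)
      hf₂ (by simpa only [Function.comp_def, hpow] using hf₁)
    simpa only [hpow] using this
  have hposf := integral_exp_pos hf₂
  have hlog := Real.log_le_log (Real.rpow_pos_of_pos hposf _) hjensen
  rw [Real.log_rpow hposf] at hlog
  calc (1 / γ₁) * Real.log (∫ x, Real.exp (γ₁ * f x) ∂ν)
      ≤ (1 / γ₁) * (γ₁ / γ₂ * Real.log (∫ x, Real.exp (γ₂ * f x) ∂ν)) :=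
        mul_le_mul_of_nonpos_left hlog (one_div_neg.mpr h₁).le
    _ = (1 / γ₂) * Real.log (∫ x, Real.exp (γ₂ * f x) ∂ν) := by
        have := h₁.ne
        field_simp
    _ ≤ (1 / γ₂) * Real.log (∫ x, Real.exp (γ₂ * g x) ∂ν) := by
        refine mul_le_mul_of_nonpos_left ?_ (one_div_neg.mpr h₂).le
        refine Real.log_le_log (integral_exp_pos hg₂) (integral_mono hg₂ hf₂ fun x => ?_)
        exact Real.exp_le_exp.mpr (mul_le_mul_of_nonpos_left (hfg x) h₂.le)

theorem ae_offerMeasure_mem {lam : Measure ℝ} {q : ℝ → ℝ → ℝ}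
    (hq : Measurable (Function.uncurry q)) {s : Set ℝ}
    (hqsupp : ∀ x θ, x ∉ s → q x θ = 0) (μ : Measure ℝ) [SFinite μ] :
    ∀ᵐ x ∂(offerMeasure lam q μ), x ∈ s := by
  have hmeas : Measurable fun x => ENNReal.ofReal (∫ θ, q x θ ∂μ) :=
    hq.stronglyMeasurable.integral_prod_right.measurable.ennreal_ofReal
  rw [offerMeasure, ae_withDensity_iff hmeas]
  refine Filter.Eventually.of_forall fun x hx => ?_
  by_contra hxs
  exact hx (by simp [hqsupp x _ hxs])

/-- The reservation levels of the exponential-utility Bayesian house selling problem are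
increasing in the risk-aversion parameter `γ`: if `γ₁ ≤ γ₂ < 0`, then
`x^{γ₁}_n(μ) ≤ x^{γ₂}_n(μ)` for all `n ≥ 1` (here `resLevel lam q c γ n = x^γ_{n+1}`). -/
theorem resLevel_increasing_in_gamma
    (lam : Measure ℝ) [SigmaFinite lam] (m M : ℝ) (hmM : m < M)
    (q : ℝ → ℝ → ℝ) (hq : Measurable (Function.uncurry q))
    (hqnn : ∀ x θ, 0 ≤ q x θ)
    (hqdens : ∀ θ, ∫ x, q x θ ∂lam = 1)
    (hqsupp : ∀ x θ, x ∉ Set.Icc m M → q x θ = 0)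
    (c : ℝ) (hc : 0 < c)
    (hmeas : ∀ γ : ℝ, γ < 0 → ∀ (n : ℕ) (μ : Measure ℝ), IsProbabilityMeasure μ →
      Measurable fun x => resLevel lam q c γ n (bayesUpdate q x μ))
    (γ₁ γ₂ : ℝ) (h₁₂ : γ₁ ≤ γ₂) (h₂ : γ₂ < 0) :
    ∀ (n : ℕ) (μ : Measure ℝ), IsProbabilityMeasure μ →
      resLevel lam q c γ₁ n μ ≤ resLevel lam q c γ₂ n μ := by
  intro n
  induction n with
  | zero =>
    intro μ hμ
    have := isProbabilityMeasure_offerMeasure hq hqnn hqdens μ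
    exact (add_le_add_iff_left _).mpr <| certaintyEquivalent_mono_s9 measurable_id measurable_id
      ((ae_offerMeasure_mem hq hqsupp μ).mono fun x hx => hx.1) (fun _ => le_rfl) h₁₂ h₂
  | succ n ih =>
    intro μ hμ
    have := isProbabilityMeasure_offerMeasure hq hqnn hqdens μ
    exact (add_le_add_iff_left _).mpr <| certaintyEquivalent_mono_s9
      (measurable_id.max (hmeas γ₁ (h₁₂.trans_lt h₂) n μ hμ))
      (measurable_id.max (hmeas γ₂ h₂ n μ hμ))
      ((ae_offerMeasure_mem hq hqsupp μ).mono fun x hx => hx.1.trans (le_max_left _ _))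
      (fun x => max_le_max le_rfl (ih _ (isProbabilityMeasure_bayesUpdate hqnn x μ))) h₁₂ h₂
end

section
/- For every horizon N ≥ 1, every 0 ≤ n ≤ N − 1 and every information state μ ∈ I, the reservation levels satisfy x_{n,N}(μ) ≤ x_{n,N+1}(μ); that is, the reservation levels are increasing in the time horizon N. -/
open MeasureTheory ProbabilityTheory

/-- The reservation levels of the general-utility house selling problem, indexed by the
number of extra remaining stages and the current time stage: `resvLevel Q Φ c U k n μ` is
the reservation level `x_{n, N}(μ)` for the horizon `N = n + k + 1`.  With
`U_n(x) = U(x − n·c)` and `U_n⁻¹(y) = n·c + U⁻¹(y)`, the backward recursion reads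
`x_{N−1,N}(μ) = U_{N−1}⁻¹(∫ U_N(x) Q(μ,dx))` and
`x_{n,N}(μ) = U_n⁻¹(∫ U_{n+1}(max{x, x_{n+1,N}(Φ(x,μ))}) Q(μ,dx))`. -/
noncomputable def resvLevel {I : Type*} [MeasurableSpace I]
    (Q : Kernel I ℝ) (Φ : ℝ → I → I) (c : ℝ) (U : ℝ ≃o ℝ) : ℕ → ℕ → I → ℝ
  | 0, n, μ => (n : ℝ) * c + U.symm (∫ x, U (x - ((n : ℝ) + 1) * c) ∂(Q μ))
  | k + 1, n, μ => (n : ℝ) * c + U.symm (∫ x,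
      U (max x (resvLevel Q Φ c U k (n + 1) (Φ x μ)) - ((n : ℝ) + 1) * c) ∂(Q μ))

lemma OrderIso.integrable_comp_sub_of_mem_Icc (P : Measure ℝ) [IsFiniteMeasure P] (U : ℝ ≃o ℝ)
    {m b : ℝ} (t : ℝ) {f : ℝ → ℝ} (hf : Measurable f) (h : ∀ᵐ x ∂P, f x ∈ Set.Icc m b) :
    Integrable (fun x => U (f x - t)) P := by
  refine Integrable.of_mem_Icc (U (m - t)) (U (b - t))
    (U.continuous.measurable.comp (hf.sub_const t)).aemeasurable ?_
  filter_upwards [h] with x hx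
  exact ⟨U.monotone (by linarith [hx.1]), U.monotone (by linarith [hx.2])⟩

lemma OrderIso.symm_integral_comp_sub_le (P : Measure ℝ) [IsProbabilityMeasure P] (U : ℝ ≃o ℝ)
    {m b : ℝ} (t : ℝ) {f : ℝ → ℝ} (hf : Measurable f) (h : ∀ᵐ x ∂P, f x ∈ Set.Icc m b) :
    U.symm (∫ x, U (f x - t) ∂P) ≤ b - t := by
  rw [U.symm_apply_le]
  calc ∫ x, U (f x - t) ∂P ≤ ∫ _, U (b - t) ∂P := by
        refine integral_mono_ae (U.integrable_comp_sub_of_mem_Icc P t hf h)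
          (integrable_const _) ?_
        filter_upwards [h] with x hx
        exact U.monotone (by linarith [hx.2])
    _ = U (b - t) := by simp

lemma ae_max_mem_Icc {P : Measure ℝ} {m b : ℝ} (h : ∀ᵐ x ∂P, x ∈ Set.Icc m b) {g : ℝ → ℝ}
    (hg : ∀ x, g x ≤ b) : ∀ᵐ x ∂P, max x (g x) ∈ Set.Icc m b := by
  filter_upwards [h] with x hx
  exact ⟨le_max_of_le_left hx.1, max_le hx.2 (hg x)⟩

section ReservationLevels

variable {I : Type*} [MeasurableSpace I] {Q : Kernel I ℝ} [IsMarkovKernel Q] {m b : ℝ}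
  {Φ : ℝ → I → I} {c : ℝ} {U : ℝ ≃o ℝ}

lemma resvLevel_le (hsupp : ∀ μ : I, ∀ᵐ x ∂(Q μ), x ∈ Set.Icc m b) (hc : 0 ≤ c)
    (hmeas : ∀ (k n : ℕ) (μ : I), Measurable fun x => resvLevel Q Φ c U k (n + 1) (Φ x μ))
    (k n : ℕ) (μ : I) : resvLevel Q Φ c U k n μ ≤ b := by
  induction k generalizing n μ with
  | zero =>
    rw [resvLevel]
    linarith [U.symm_integral_comp_sub_le (Q μ) (f := fun x => x) (((n : ℝ) + 1) * c)
      measurable_id (hsupp μ)]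
  | succ k ih =>
    rw [resvLevel]
    linarith [U.symm_integral_comp_sub_le (Q μ)
      (f := fun x => max x (resvLevel Q Φ c U k (n + 1) (Φ x μ))) (((n : ℝ) + 1) * c)
      (measurable_id.max (hmeas k n μ)) (ae_max_mem_Icc (hsupp μ) fun x => ih (n + 1) (Φ x μ))]

lemma resvLevel_le_succ (hsupp : ∀ μ : I, ∀ᵐ x ∂(Q μ), x ∈ Set.Icc m b) (hc : 0 ≤ c)
    (hmeas : ∀ (k n : ℕ) (μ : I), Measurable fun x => resvLevel Q Φ c U k (n + 1) (Φ x μ))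
    (k n : ℕ) (μ : I) : resvLevel Q Φ c U k n μ ≤ resvLevel Q Φ c U (k + 1) n μ := by
  have hint (k n : ℕ) (μ : I) : Integrable (fun x =>
      U (max x (resvLevel Q Φ c U k (n + 1) (Φ x μ)) - ((n : ℝ) + 1) * c)) (Q μ) :=
    U.integrable_comp_sub_of_mem_Icc (Q μ) _ (measurable_id.max (hmeas k n μ))
      (ae_max_mem_Icc (hsupp μ) fun x => resvLevel_le hsupp hc hmeas k (n + 1) (Φ x μ))
  induction k generalizing n μ with
  | zero =>
    rw [resvLevel, resvLevel]
    refine add_le_add_right (U.symm.monotone (integral_mono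
      (U.integrable_comp_sub_of_mem_Icc (Q μ) _ measurable_id (hsupp μ)) (hint 0 n μ)
      fun x => U.monotone ?_)) _
    exact sub_le_sub_right (le_max_left _ _) _
  | succ k ih =>
    rw [resvLevel, resvLevel]
    refine add_le_add_right (U.symm.monotone (integral_mono (hint k n μ) (hint (k + 1) n μ)
      fun x => U.monotone ?_)) _
    exact sub_le_sub_right (max_le_max_left _ (ih (n + 1) (Φ x μ))) _

end ReservationLevels

/-- The reservation levels are increasing in the time horizon `N`: for every horizon
`N ≥ 1`, every `0 ≤ n ≤ N − 1` and every information state `μ`,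
`x_{n,N}(μ) ≤ x_{n,N+1}(μ)`  (here `x_{n,N} = resvLevel Q Φ c U (N − 1 − n) n`). -/
theorem reservation_levels_increasing_in_horizon
    {I : Type*} [MeasurableSpace I]
    (Q : Kernel I ℝ) [IsMarkovKernel Q]
    (m b : ℝ) (hmb : m ≤ b) (hsupp : ∀ μ : I, Q μ (Set.Icc m b)ᶜ = 0)
    (Φ : ℝ → I → I) (hΦ : Measurable (Function.uncurry Φ))
    (c : ℝ) (hc : 0 < c)
    (U : ℝ ≃o ℝ) (hUconc : ConcaveOn ℝ Set.univ U)
    (hmeas : ∀ (k n : ℕ) (μ : I),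
      Measurable fun x => resvLevel Q Φ c U k (n + 1) (Φ x μ)) :
    ∀ (N n : ℕ) (μ : I), 1 ≤ N → n ≤ N - 1 →
      resvLevel Q Φ c U (N - 1 - n) n μ ≤ resvLevel Q Φ c U (N - n) n μ := by
  intro N n μ hN hn
  rw [show N - n = N - 1 - n + 1 by omega]
  exact resvLevel_le_succ (fun μ => mem_ae_iff.2 (hsupp μ)) hc.le hmeas (N - 1 - n) n μ
end
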